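/- arXiv:1912.10242 — 3 statements merged into one kernel-verified Lean document; each statement's English description precedes it below -/
import Mathlib

section
/- Fix real parameters a, d, ν and let v be the Beltrami velocity field v₁ = −a e^{−νd²t}(e^{ax} sin(dz+ay) + cos(dy+ax) e^{az}), v₂ = −a e^{−νd²t}(e^{ax} cos(dz+ay) + e^{ay} sin(az+dx)), v₃ = −a e^{−νd²t}(e^{ay} cos(az+dx) + sin(dy+ax) e^{az}). Then the velocity and vorticity vectors are aligned: at every point and time, ∇×v = d·v, i.e., (∂₂v₃ − ∂₃v₂, ∂₃v₁ − ∂₁v₃, ∂₁v₂ − ∂₂v₁) = d·(v₁, v₂, v₃). -/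
noncomputable section

/-- First component of the Beltrami (Ethier–Steinman) velocity field. -/
def bv1 (a d ν x y z t : ℝ) : ℝ :=
  -a * Real.exp (-ν*d^2*t) *
    (Real.exp (a*x) * Real.sin (d*z + a*y) + Real.cos (d*y + a*x) * Real.exp (a*z))

/-- Second component of the Beltrami (Ethier–Steinman) velocity field. -/
def bv2 (a d ν x y z t : ℝ) : ℝ :=
  -a * Real.exp (-ν*d^2*t) *
    (Real.exp (a*x) * Real.cos (d*z + a*y) + Real.exp (a*y) * Real.sin (a*z + d*x))

/-- Third component of the Beltrami (Ethier–Steinman) velocity field. -/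
def bv3 (a d ν x y z t : ℝ) : ℝ :=
  -a * Real.exp (-ν*d^2*t) *
    (Real.exp (a*y) * Real.cos (a*z + d*x) + Real.sin (d*y + a*x) * Real.exp (a*z))

/-- Partial derivative with respect to the first spatial variable. -/
def pd1 (f : ℝ → ℝ → ℝ → ℝ) (x y z : ℝ) : ℝ := deriv (fun s => f s y z) x

/-- Partial derivative with respect to the second spatial variable. -/
def pd2 (f : ℝ → ℝ → ℝ → ℝ) (x y z : ℝ) : ℝ := deriv (fun s => f x s z) y

/-- Partial derivative with respect to the third spatial variable. -/
def pd3 (f : ℝ → ℝ → ℝ → ℝ) (x y z : ℝ) : ℝ := deriv (fun s => f x y s) z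

theorem hasDerivAt_bv1_y (a d ν x y z t : ℝ) :
    HasDerivAt (fun s => bv1 a d ν x s z t)
      (-a * Real.exp (-ν*d^2*t) *
        (Real.exp (a*x) * (Real.cos (d*z + a*y) * a)
          + -Real.sin (d*y + a*x) * d * Real.exp (a*z))) y :=
  ((((hasDerivAt_const_mul a).const_add (d*z)).sin.const_mul (Real.exp (a*x))).add
    (((hasDerivAt_const_mul d).add_const (a*x)).cos.mul_const (Real.exp (a*z)))).const_mul _

theorem hasDerivAt_bv1_z (a d ν x y z t : ℝ) :
    HasDerivAt (fun s => bv1 a d ν x y s t)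
      (-a * Real.exp (-ν*d^2*t) *
        (Real.exp (a*x) * (Real.cos (d*z + a*y) * d)
          + Real.cos (d*y + a*x) * (Real.exp (a*z) * a))) z :=
  ((((hasDerivAt_const_mul d).add_const (a*y)).sin.const_mul (Real.exp (a*x))).add
    ((hasDerivAt_const_mul a).exp.const_mul (Real.cos (d*y + a*x)))).const_mul _

theorem hasDerivAt_bv2_x (a d ν x y z t : ℝ) :
    HasDerivAt (fun s => bv2 a d ν s y z t)
      (-a * Real.exp (-ν*d^2*t) *
        (Real.exp (a*x) * a * Real.cos (d*z + a*y)
          + Real.exp (a*y) * (Real.cos (a*z + d*x) * d))) x :=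
  (((hasDerivAt_const_mul a).exp.mul_const (Real.cos (d*z + a*y))).add
    (((hasDerivAt_const_mul d).const_add (a*z)).sin.const_mul (Real.exp (a*y)))).const_mul _

theorem hasDerivAt_bv2_z (a d ν x y z t : ℝ) :
    HasDerivAt (fun s => bv2 a d ν x y s t)
      (-a * Real.exp (-ν*d^2*t) *
        (Real.exp (a*x) * (-Real.sin (d*z + a*y) * d)
          + Real.exp (a*y) * (Real.cos (a*z + d*x) * a))) z :=
  ((((hasDerivAt_const_mul d).add_const (a*y)).cos.const_mul (Real.exp (a*x))).add
    (((hasDerivAt_const_mul a).add_const (d*x)).sin.const_mul (Real.exp (a*y)))).const_mul _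

theorem hasDerivAt_bv3_x (a d ν x y z t : ℝ) :
    HasDerivAt (fun s => bv3 a d ν s y z t)
      (-a * Real.exp (-ν*d^2*t) *
        (Real.exp (a*y) * (-Real.sin (a*z + d*x) * d)
          + Real.cos (d*y + a*x) * a * Real.exp (a*z))) x :=
  ((((hasDerivAt_const_mul d).const_add (a*z)).cos.const_mul (Real.exp (a*y))).add
    (((hasDerivAt_const_mul a).const_add (d*y)).sin.mul_const (Real.exp (a*z)))).const_mul _

theorem hasDerivAt_bv3_y (a d ν x y z t : ℝ) :
    HasDerivAt (fun s => bv3 a d ν x s z t)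
      (-a * Real.exp (-ν*d^2*t) *
        (Real.exp (a*y) * a * Real.cos (a*z + d*x)
          + Real.cos (d*y + a*x) * d * Real.exp (a*z))) y :=
  (((hasDerivAt_const_mul a).exp.mul_const (Real.cos (a*z + d*x))).add
    (((hasDerivAt_const_mul d).add_const (a*x)).sin.mul_const (Real.exp (a*z)))).const_mul _

/-- Velocity and vorticity of the Beltrami field are aligned: `∇×v = d • v`
at every point and time. -/
theorem stmt7 (a d ν : ℝ) :
    ∀ t x y z : ℝ,
      (pd2 (fun p q r => bv3 a d ν p q r t) x y z
        - pd3 (fun p q r => bv2 a d ν p q r t) x y z = d * bv1 a d ν x y z t)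
      ∧ (pd3 (fun p q r => bv1 a d ν p q r t) x y z
        - pd1 (fun p q r => bv3 a d ν p q r t) x y z = d * bv2 a d ν x y z t)
      ∧ (pd1 (fun p q r => bv2 a d ν p q r t) x y z
        - pd2 (fun p q r => bv1 a d ν p q r t) x y z = d * bv3 a d ν x y z t) := by
  intro t x y z
  simp only [pd1, pd2, pd3, (hasDerivAt_bv1_y a d ν x y z t).deriv,
    (hasDerivAt_bv1_z a d ν x y z t).deriv, (hasDerivAt_bv2_x a d ν x y z t).deriv,
    (hasDerivAt_bv2_z a d ν x y z t).deriv, (hasDerivAt_bv3_x a d ν x y z t).deriv,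
    (hasDerivAt_bv3_y a d ν x y z t).deriv]
  simp only [bv1, bv2, bv3]
  refine ⟨?_, ?_, ?_⟩ <;> ring

end
end

section
/- Fix real parameters a, d, ν and ρ > 0, let v be the Beltrami velocity field v₁ = −a e^{−νd²t}(e^{ax} sin(dz+ay) + cos(dy+ax) e^{az}), v₂ = −a e^{−νd²t}(e^{ax} cos(dz+ay) + e^{ay} sin(az+dx)), v₃ = −a e^{−νd²t}(e^{ay} cos(az+dx) + sin(dy+ax) e^{az}), and let p(x,y,z,t) = p₀(t) − (1/2) a² ρ e^{−2νd²t}[2 cos(dy+ax) e^{a(z+x)} sin(dz+ay) + 2 e^{a(y+x)} sin(az+dx) cos(dz+ay) + 2 sin(dy+ax) e^{a(z+y)} cos(az+dx) + e^{2az} + e^{2ay} + e^{2ax}] for an arbitrary function p₀ of time. Then the nonlinear convection term is balanced by the pressure gradient: ρ (v·∇)v = −∇p at every point and time, where ∇p denotes the spatial gradient. -/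
noncomputable section

/-- Pressure of the Beltrami (Ethier–Steinman) flow, with arbitrary time offset `p₀`. -/
def bp (a d ν ρ : ℝ) (p₀ : ℝ → ℝ) (x y z t : ℝ) : ℝ :=
  p₀ t - (1/2) * a^2 * ρ * Real.exp (-2*ν*d^2*t) *
    (2 * Real.cos (d*y + a*x) * Real.exp (a*(z+x)) * Real.sin (d*z + a*y)
      + 2 * Real.exp (a*(y+x)) * Real.sin (a*z + d*x) * Real.cos (d*z + a*y)
      + 2 * Real.sin (d*y + a*x) * Real.exp (a*(z+y)) * Real.cos (a*z + d*x)
      + Real.exp (2*a*z) + Real.exp (2*a*y) + Real.exp (2*a*x))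

/-- For the Beltrami flow, the nonlinear convection term is balanced by the pressure
gradient: `ρ (v·∇)v = −∇p` at every point and time. -/
theorem stmt8 (a d ν ρ : ℝ) (hρ : 0 < ρ) (p₀ : ℝ → ℝ) :
    ∀ t x y z : ℝ,
      (ρ * (bv1 a d ν x y z t * pd1 (fun p q r => bv1 a d ν p q r t) x y z
          + bv2 a d ν x y z t * pd2 (fun p q r => bv1 a d ν p q r t) x y z
          + bv3 a d ν x y z t * pd3 (fun p q r => bv1 a d ν p q r t) x y z)
        = -pd1 (fun p q r => bp a d ν ρ p₀ p q r t) x y z)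
      ∧ (ρ * (bv1 a d ν x y z t * pd1 (fun p q r => bv2 a d ν p q r t) x y z
          + bv2 a d ν x y z t * pd2 (fun p q r => bv2 a d ν p q r t) x y z
          + bv3 a d ν x y z t * pd3 (fun p q r => bv2 a d ν p q r t) x y z)
        = -pd2 (fun p q r => bp a d ν ρ p₀ p q r t) x y z)
      ∧ (ρ * (bv1 a d ν x y z t * pd1 (fun p q r => bv3 a d ν p q r t) x y z
          + bv2 a d ν x y z t * pd2 (fun p q r => bv3 a d ν p q r t) x y z
          + bv3 a d ν x y z t * pd3 (fun p q r => bv3 a d ν p q r t) x y z)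
        = -pd3 (fun p q r => bp a d ν ρ p₀ p q r t) x y z) := by
  intro t x y z
  have hexp (u v : ℝ) : Real.exp (a * (u + v)) = Real.exp (a * u) * Real.exp (a * v) := by
    rw [mul_add, Real.exp_add]
  have hsq (u : ℝ) : Real.exp (2 * a * u) = Real.exp (a * u) ^ 2 := by
    rw [← Real.exp_nat_mul]; push_cast; ring_nf
  have htime : Real.exp (-2 * ν * d ^ 2 * t) = Real.exp (-ν * d ^ 2 * t) ^ 2 := by
    rw [← Real.exp_nat_mul]; push_cast; ring_nf
  have hlin (c u : ℝ) : deriv (fun s => c * s) u = c := by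
    simp
  have h₁ := Real.sin_sq_add_cos_sq (d * z + a * y)
  have h₂ := Real.sin_sq_add_cos_sq (d * y + a * x)
  have h₃ := Real.sin_sq_add_cos_sq (a * z + d * x)
  simp only [pd1, pd2, pd3, bv1, bv2, bv3, bp, hexp, hsq, htime]
  refine ⟨?_, ?_, ?_⟩
  all_goals
    simp (disch := fun_prop) only [deriv_fun_add, deriv_const_sub, deriv_const_mul_field,
      deriv_fun_mul, deriv_fun_pow, deriv_exp, deriv_sin, deriv_cos, deriv_const, hlin]
    clear hexp hsq htime hlin
    generalize Real.exp (-ν * d ^ 2 * t) = T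
    generalize Real.exp (a * x) = X
    generalize Real.exp (a * y) = Y
    generalize Real.exp (a * z) = Z
    generalize Real.sin (d * z + a * y) = s₁ at *
    generalize Real.cos (d * z + a * y) = c₁ at *
    generalize Real.sin (d * y + a * x) = s₂ at *
    generalize Real.cos (d * y + a * x) = c₂ at *
    generalize Real.sin (a * z + d * x) = s₃ at *
    generalize Real.cos (a * z + d * x) = c₃ at *
  all_goals grind


end
end

section
/- Fix real parameters a, d, let ρ > 0, ν > 0, μ = ρν, let v be the Beltrami velocity field v₁ = −a e^{−νd²t}(e^{ax} sin(dz+ay) + cos(dy+ax) e^{az}), v₂ = −a e^{−νd²t}(e^{ax} cos(dz+ay) + e^{ay} sin(az+dx)), v₃ = −a e^{−νd²t}(e^{ay} cos(az+dx) + sin(dy+ax) e^{az}), and let p = p₀(t) − (1/2) a² ρ e^{−2νd²t}[2cos(dy+ax)e^{a(z+x)}sin(dz+ay) + 2e^{a(y+x)}sin(az+dx)cos(dz+ay) + 2sin(dy+ax)e^{a(z+y)}cos(az+dx) + e^{2az} + e^{2ay} + e^{2ax}] with p₀ a differentiable function of time. Then (v,p) solves the instationary incompressible Navier-Stokes equations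 with zero force: ρ ∂_t v − μ Δv + ρ (v·∇)v + ∇p = 0 and ∇·v = 0 hold pointwise on ℝ³ × ℝ, where ∇p is the spatial gradient. -/
noncomputable section

/-- Spatial Laplacian of a scalar function of three variables. -/
def lap3 (f : ℝ → ℝ → ℝ → ℝ) (x y z : ℝ) : ℝ :=
  pd1 (pd1 f) x y z + pd2 (pd2 f) x y z + pd3 (pd3 f) x y z

/-- The Beltrami flow `(v, p)` solves the instationary incompressible Navier-Stokes
equations with zero force: `ρ ∂ₜv − μ Δv + ρ (v·∇)v + ∇p = 0` and `∇·v = 0` pointwise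
on `ℝ³ × ℝ`, where `μ = ρ ν`. -/
theorem stmt9 (a d ν ρ μ : ℝ) (hρ : 0 < ρ) (hν : 0 < ν) (hμ : μ = ρ * ν)
    (p₀ : ℝ → ℝ) (hp₀ : Differentiable ℝ p₀) :
    ∀ t x y z : ℝ,
      (ρ * deriv (fun s => bv1 a d ν x y z s) t
        - μ * lap3 (fun p q r => bv1 a d ν p q r t) x y z
        + ρ * (bv1 a d ν x y z t * pd1 (fun p q r => bv1 a d ν p q r t) x y z
          + bv2 a d ν x y z t * pd2 (fun p q r => bv1 a d ν p q r t) x y z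
          + bv3 a d ν x y z t * pd3 (fun p q r => bv1 a d ν p q r t) x y z)
        + pd1 (fun p q r => bp a d ν ρ p₀ p q r t) x y z = 0)
      ∧ (ρ * deriv (fun s => bv2 a d ν x y z s) t
        - μ * lap3 (fun p q r => bv2 a d ν p q r t) x y z
        + ρ * (bv1 a d ν x y z t * pd1 (fun p q r => bv2 a d ν p q r t) x y z
          + bv2 a d ν x y z t * pd2 (fun p q r => bv2 a d ν p q r t) x y z
          + bv3 a d ν x y z t * pd3 (fun p q r => bv2 a d ν p q r t) x y z)
        + pd2 (fun p q r => bp a d ν ρ p₀ p q r t) x y z = 0)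
      ∧ (ρ * deriv (fun s => bv3 a d ν x y z s) t
        - μ * lap3 (fun p q r => bv3 a d ν p q r t) x y z
        + ρ * (bv1 a d ν x y z t * pd1 (fun p q r => bv3 a d ν p q r t) x y z
          + bv2 a d ν x y z t * pd2 (fun p q r => bv3 a d ν p q r t) x y z
          + bv3 a d ν x y z t * pd3 (fun p q r => bv3 a d ν p q r t) x y z)
        + pd3 (fun p q r => bp a d ν ρ p₀ p q r t) x y z = 0)
      ∧ (pd1 (fun p q r => bv1 a d ν p q r t) x y z
        + pd2 (fun p q r => bv2 a d ν p q r t) x y z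
        + pd3 (fun p q r => bv3 a d ν p q r t) x y z = 0) := by
  have exp_two_mul (u : ℝ) : Real.exp (2*a*u) = Real.exp (a*u) ^ 2 := by
    rw [← Real.exp_nat_mul]; push_cast; ring_nf
  have exp_two_mul_time (t : ℝ) : Real.exp (-2*ν*d^2*t) = Real.exp (-ν*d^2*t) ^ 2 := by
    rw [← Real.exp_nat_mul]; push_cast; ring_nf
  have deriv_mul_left (c : ℝ) : deriv (HMul.hMul c) = fun _ => c := by
    funext u
    simp
  intro t x y z
  subst hμ
  have hA := Real.sin_sq_add_cos_sq (d*z + a*y)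
  have hB := Real.sin_sq_add_cos_sq (d*y + a*x)
  have hC := Real.sin_sq_add_cos_sq (a*z + d*x)
  simp only [lap3, pd1, pd2, pd3, bv1, bv2, bv3, bp, exp_two_mul, exp_two_mul_time, mul_add,
    Real.exp_add]
  simp (disch := fun_prop) only [deriv_fun_add, deriv_fun_sub, deriv_fun_mul, deriv_exp,
    deriv_fun_pow, deriv_sin, deriv_cos, deriv_const, deriv.fun_neg, deriv_mul_left]
  generalize Real.sin (d*z + a*y) = sA at *
  generalize Real.cos (d*z + a*y) = cA at *
  generalize Real.sin (d*y + a*x) = sB at *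
  generalize Real.cos (d*y + a*x) = cB at *
  generalize Real.sin (a*z + d*x) = sC at *
  generalize Real.cos (a*z + d*x) = cC at *
  generalize Real.exp (a*x) = ex at *
  generalize Real.exp (a*y) = ey at *
  generalize Real.exp (a*z) = ez at *
  generalize Real.exp (-ν*d^2*t) = T at *
  refine ⟨?_, ?_, ?_, ?_⟩
  · linear_combination (ρ * T^2 * a^3 * ex^2) * hA
  · linear_combination (ρ * T^2 * a^3 * ey^2) * hC
  · linear_combination (ρ * T^2 * a^3 * ez^2) * hB
  · ring

end
end
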